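/- Let k ≥ 0 and n = 6k + 7. Work over R = (ℤ/2ℤ)[t,t⁻¹], the Laurent polynomial ring over the field ℤ/2ℤ. Define 2×2 matrices B₁, …, Bₙ over R as follows: B₁ = t^(−(6k+6))·[[t + t^(6k+6), 1+t],[1, t + t^(6k+6)]]; for 2 ≤ j ≤ 6k+2 with j ≡ 2 (mod 3), B_j = t^(j−6k−8)·[[t+t², 1+t],[1+t², t+t²]]; for 3 ≤ j ≤ 6k with j ≡ 0 (mod 3), B_j = t^(j−6k−8)·[[1+t, 1+t²],[t+t², 1+t]]; for 4 ≤ j ≤ 6k+1 with j ≡ 1 (mod 3), B_j = t^(j−6k−8)·[[1+t², t+t²],[1+t, 1+t²]]; B_{6k+3} = t^(−5)·[[1+t, 1+t²],[t+t², 1+t+t²]]; B_{6k+4} = t^(−4)·[[1+t, t+t²],[1+t², 1+t+t²]]; B_{6k+5} = t^(−3)·[[1+t, 1+t²],[t², 1+t]]; B_{6k+6} = t^(−(6k+7))·[[t^(6k+5)+t^(6k+6), 1+t^(6k+5)],[1, 1+t^(6k+5)+t^(6k+6)]]; B_{6k+7} = t^(−1)·[[1+t, 1+t²],[t², 1+t+t²]].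 Let A be the 2×(2n) matrix over R obtained by concatenating the blocks B₁, …, Bₙ left to right. Then the ideal of R generated by all 2×2 minors of A equals the principal ideal generated by 1 + t. (This is the computation of the (2n−2)-nd twisted Alexander ideal of Suzuki's theta-n curve for n ≡ 1 (mod 6), showing it equals (1+t).) -/

import Mathlib

open LaurentPolynomial

set_option maxHeartbeats 1000000

/-- The scalar `2` vanishes in Laurent polynomials over `ℤ/2ℤ`. -/
lemma laurent_two_eq_zero : (2 : LaurentPolynomial (ZMod 2)) = 0 := by
  have h : (C (2 : ZMod 2) : LaurentPolynomial (ZMod 2)) = 2 := map_ofNat C 2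
  rw [← h, show (2 : ZMod 2) = 0 from rfl, map_zero]

lemma one_add_T_dvd_one_add_T (m : ℕ) :
    (1 + T 1 : LaurentPolynomial (ZMod 2)) ∣ 1 + T (m : ℤ) := by
  have h := sub_dvd_pow_sub_pow (T 1 : LaurentPolynomial (ZMod 2)) 1 m
  have e : (T 1 : LaurentPolynomial (ZMod 2)) ^ m = T (m : ℤ) := by rw [T_pow, mul_one]
  rw [one_pow, e] at h
  convert h using 1 <;> linear_combination laurent_two_eq_zero

lemma one_add_T_dvd_T_add_T (m n : ℕ) :
    (1 + T 1 : LaurentPolynomial (ZMod 2)) ∣ T (m : ℤ) + T (n : ℤ) := by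
  convert dvd_add (one_add_T_dvd_one_add_T m) (one_add_T_dvd_one_add_T n) using 1
  linear_combination -laurent_two_eq_zero

/-- For `n = 6k + 7`, the ideal of `(ℤ/2ℤ)[t,t⁻¹]` generated by the `2×2` minors of
the `2×2n` twisted Alexander matrix `A = (B₁ B₂ ⋯ Bₙ)` of Suzuki's theta-`n` curve
equals the principal ideal `(1 + t)`. -/
theorem twisted_alexander_ideal_6k7 (k n : ℕ) (hn : n = 6 * k + 7)
    (B : ℕ → Matrix (Fin 2) (Fin 2) (LaurentPolynomial (ZMod 2)))
    (A : Matrix (Fin 2) (Fin (2 * n)) (LaurentPolynomial (ZMod 2)))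
    (hB1 : B 1 = (T (-(6 * (k : ℤ) + 6)) : LaurentPolynomial (ZMod 2)) •
      !![T 1 + T (6 * (k : ℤ) + 6), 1 + T 1;
         1, T 1 + T (6 * (k : ℤ) + 6)])
    (hBtwo : ∀ j, 2 ≤ j → j ≤ 6 * k + 2 → j % 3 = 2 →
      B j = (T ((j : ℤ) - 6 * k - 8) : LaurentPolynomial (ZMod 2)) •
        !![T 1 + T 2, 1 + T 1; 1 + T 2, T 1 + T 2])
    (hBzero : ∀ j, 3 ≤ j → j ≤ 6 * k → j % 3 = 0 →
      B j = (T ((j : ℤ) - 6 * k - 8) : LaurentPolynomial (ZMod 2)) •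
        !![1 + T 1, 1 + T 2; T 1 + T 2, 1 + T 1])
    (hBone : ∀ j, 4 ≤ j → j ≤ 6 * k + 1 → j % 3 = 1 →
      B j = (T ((j : ℤ) - 6 * k - 8) : LaurentPolynomial (ZMod 2)) •
        !![1 + T 2, T 1 + T 2; 1 + T 1, 1 + T 2])
    (hB3 : B (6 * k + 3) = (T (-5) : LaurentPolynomial (ZMod 2)) •
      !![1 + T 1, 1 + T 2; T 1 + T 2, 1 + T 1 + T 2])
    (hB4 : B (6 * k + 4) = (T (-4) : LaurentPolynomial (ZMod 2)) •
      !![1 + T 1, T 1 + T 2; 1 + T 2, 1 + T 1 + T 2])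
    (hB5 : B (6 * k + 5) = (T (-3) : LaurentPolynomial (ZMod 2)) •
      !![1 + T 1, 1 + T 2; T 2, 1 + T 1])
    (hB6 : B (6 * k + 6) = (T (-(6 * (k : ℤ) + 7)) : LaurentPolynomial (ZMod 2)) •
      !![T (6 * (k : ℤ) + 5) + T (6 * (k : ℤ) + 6), 1 + T (6 * (k : ℤ) + 5);
         1, 1 + T (6 * (k : ℤ) + 5) + T (6 * (k : ℤ) + 6)])
    (hB7 : B (6 * k + 7) = (T (-1) : LaurentPolynomial (ZMod 2)) •
      !![1 + T 1, 1 + T 2; T 2, 1 + T 1 + T 2])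
    (hA : ∀ (i : Fin 2) (j : Fin (2 * n)),
      A i j = B (j.val / 2 + 1) i ⟨j.val % 2, Nat.mod_lt _ (by norm_num)⟩) :
    Ideal.span {d : LaurentPolynomial (ZMod 2) | ∃ c₁ c₂ : Fin (2 * n), c₁ < c₂ ∧
        d = (A.submatrix id ![c₁, c₂]).det} =
      Ideal.span {1 + T 1} := by
  subst hn
  have d01 : (1 + T 1 : LaurentPolynomial (ZMod 2)) ∣ 1 + T 1 := dvd_rfl
  have d02 : (1 + T 1 : LaurentPolynomial (ZMod 2)) ∣ 1 + T 2 := one_add_T_dvd_one_add_T 2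
  have d12 : (1 + T 1 : LaurentPolynomial (ZMod 2)) ∣ T 1 + T 2 := one_add_T_dvd_T_add_T 1 2
  have d05 : (1 + T 1 : LaurentPolynomial (ZMod 2)) ∣ 1 + T (6 * (k : ℤ) + 5) := by
    exact_mod_cast one_add_T_dvd_one_add_T (6 * k + 5)
  have d16 : (1 + T 1 : LaurentPolynomial (ZMod 2)) ∣ T 1 + T (6 * (k : ℤ) + 6) := by
    exact_mod_cast one_add_T_dvd_T_add_T 1 (6 * k + 6)
  have d56 : (1 + T 1 : LaurentPolynomial (ZMod 2)) ∣
      T (6 * (k : ℤ) + 5) + T (6 * (k : ℤ) + 6) := by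
    exact_mod_cast one_add_T_dvd_T_add_T (6 * k + 5) (6 * k + 6)
  have top_row (j : ℕ) (hj : 1 ≤ j) (hj' : j ≤ 6 * k + 7) (c : Fin 2) :
      (1 + T 1 : LaurentPolynomial (ZMod 2)) ∣ B j 0 c := by
    have hcases : j = 1 ∨ (2 ≤ j ∧ j ≤ 6 * k + 2 ∧ j % 3 = 2) ∨
        (3 ≤ j ∧ j ≤ 6 * k ∧ j % 3 = 0) ∨ (4 ≤ j ∧ j ≤ 6 * k + 1 ∧ j % 3 = 1) ∨
        j = 6 * k + 3 ∨ j = 6 * k + 4 ∨ j = 6 * k + 5 ∨ j = 6 * k + 6 ∨ j = 6 * k + 7 := by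
      omega
    rcases hcases with
      rfl | ⟨h1, h2, h3⟩ | ⟨h1, h2, h3⟩ | ⟨h1, h2, h3⟩ | rfl | rfl | rfl | rfl | rfl
    · rw [hB1]
      fin_cases c <;> exact Dvd.dvd.mul_left ‹_› _
    · rw [hBtwo j h1 h2 h3]
      fin_cases c <;> exact Dvd.dvd.mul_left ‹_› _
    · rw [hBzero j h1 h2 h3]
      fin_cases c <;> exact Dvd.dvd.mul_left ‹_› _
    · rw [hBone j h1 h2 h3]
      fin_cases c <;> exact Dvd.dvd.mul_left ‹_› _
    · rw [hB3]
      fin_cases c <;> exact Dvd.dvd.mul_left ‹_› _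
    · rw [hB4]
      fin_cases c <;> exact Dvd.dvd.mul_left ‹_› _
    · rw [hB5]
      fin_cases c <;> exact Dvd.dvd.mul_left ‹_› _
    · rw [hB6]
      fin_cases c <;> exact Dvd.dvd.mul_left ‹_› _
    · rw [hB7]
      fin_cases c <;> exact Dvd.dvd.mul_left ‹_› _
  have block_minor (j : ℕ) (hj : j < 6 * k + 7) : (B (j + 1)).det ∈
      Ideal.span {d : LaurentPolynomial (ZMod 2) | ∃ c₁ c₂ : Fin (2 * (6 * k + 7)), c₁ < c₂ ∧
        d = (A.submatrix id ![c₁, c₂]).det} := by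
    refine Ideal.subset_span ⟨⟨2 * j, by omega⟩, ⟨2 * j + 1, by omega⟩, ?_, ?_⟩
    · simp [Fin.lt_def]
    · have q : (2 * j + 1) / 2 = j := by omega
      have r : (2 * j + 1) % 2 = 1 := by omega
      simp [Matrix.det_fin_two, hA, q, r]
  apply le_antisymm
  · rw [Ideal.span_le]
    rintro d ⟨c₁, c₂, -, rfl⟩
    have row (c : Fin (2 * (6 * k + 7))) : (1 + T 1 : LaurentPolynomial (ZMod 2)) ∣ A 0 c := by
      rw [hA]
      exact top_row _ (by omega) (by omega) _
    rw [SetLike.mem_coe, Ideal.mem_span_singleton, Matrix.det_fin_two]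
    exact dvd_sub ((row c₁).mul_right _) ((row c₂).mul_right _)
  · rw [Ideal.span_singleton_le_iff_mem]
    have h5 := block_minor (6 * k + 4) (by omega)
    have h7 := block_minor (6 * k + 6) (by omega)
    rw [hB5] at h5
    rw [hB7] at h7
    have e2 : (T 1 ^ 2 : LaurentPolynomial (ZMod 2)) = T 2 := by rw [T_pow]; rfl
    have u5 : (T 6 * T (-3) ^ 2 : LaurentPolynomial (ZMod 2)) = 1 := by
      rw [T_pow, ← T_add, ← T_zero]; rfl
    have u7 : (T 2 * T (-1) ^ 2 : LaurentPolynomial (ZMod 2)) = 1 := by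
      rw [T_pow, ← T_add, ← T_zero]; rfl
    convert add_mem (Ideal.mul_mem_left _ (T 1 ^ 2 * T 2) h7)
      (Ideal.mul_mem_left _ ((1 + T 1 + T 1 ^ 2) * T 6) h5) using 1
    simp only [Matrix.det_smul, Fintype.card_fin, Matrix.det_fin_two_of]
    rw [← e2] at u7 ⊢
    generalize (T 1 : LaurentPolynomial (ZMod 2)) = x at *
    linear_combination
      -(x ^ 2 * ((1 + x) * (1 + x + x ^ 2) - (1 + x ^ 2) * x ^ 2)) * u7
      - ((1 + x + x ^ 2) * ((1 + x) * (1 + x) - (1 + x ^ 2) * x ^ 2)) * u5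
      + (x ^ 6 - 2 * x ^ 3 - 2 * x ^ 2 - x) * laurent_two_eq_zero
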